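/- Let k ≥ ℓ ≥ 1 and n ≥ k+ℓ be integers and let w ∈ V(n,k,ℓ) satisfy: (i) Σ_{j≥i} w_j ≥ 0 for every i ∈ [n], and (ii) |S_+(w) ∩ [2t−1]| ≤ t−1 for every integer t ≥ 1. Then there exists v ∈ V(n,k,ℓ) such that v ≺ w in the shifting partial order and ⟨v,w⟩ = −2ℓ. -/

import Mathlib

/-- `v` is a `{0,1,-1}`-vector of length `n` with exactly `k` coordinates equal to `+1`
and exactly `l` coordinates equal to `-1`, i.e. `v ∈ V(n,k,l)`. -/
def IsPMVec (n k l : ℕ) (v : Fin n → ℤ) : Prop :=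
  (∀ i, v i = 0 ∨ v i = 1 ∨ v i = -1) ∧
  (Finset.univ.filter fun i => v i = 1).card = k ∧
  (Finset.univ.filter fun i => v i = -1).card = l

/-- the standard scalar product -/
def dotZ {n : ℕ} (v w : Fin n → ℤ) : ℤ := ∑ i, v i * w i

/-- `v` is obtained from `w` by a single `(i ← j)`-shift (`i < j`): the pair
`(w i, w j)` is replaced by `(max (w i) (w j), min (w i) (w j))`. -/
def ShiftStep {n : ℕ} (w v : Fin n → ℤ) : Prop :=
  ∃ i j : Fin n, i < j ∧
    v = Function.update (Function.update w i (max (w i) (w j))) j (min (w i) (w j))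

/-- `v ≺ w` in the shifting partial order: `v` is obtained from `w` by a finite
(possibly empty) sequence of `(i ← j)`-shifts. -/
def Precedes {n : ℕ} (v w : Fin n → ℤ) : Prop :=
  Relation.ReflTransGen ShiftStep w v

theorem ShiftStep.exists_perm {n : ℕ} {w v : Fin n → ℤ} (h : ShiftStep w v) :
    ∃ σ : Equiv.Perm (Fin n), v = w ∘ σ := by
  obtain ⟨i, j, hij, rfl⟩ := h
  rcases le_total (w i) (w j) with hle | hle
  · refine ⟨Equiv.swap i j, ?_⟩
    rw [max_eq_right hle, min_eq_left hle, Equiv.comp_swap_eq_update,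
      Function.update_comm hij.ne]
  · exact ⟨1, by simp [hle]⟩

theorem Precedes.exists_perm {n : ℕ} {v w : Fin n → ℤ} (h : Precedes v w) :
    ∃ σ : Equiv.Perm (Fin n), v = w ∘ σ := by
  induction h with
  | refl => exact ⟨1, rfl⟩
  | tail _ hs ih =>
    obtain ⟨σ, rfl⟩ := ih
    obtain ⟨τ, rfl⟩ := hs.exists_perm
    exact ⟨τ.trans σ, rfl⟩

theorem IsPMVec.comp_perm {n k l : ℕ} {w : Fin n → ℤ} (hw : IsPMVec n k l w)
    (σ : Equiv.Perm (Fin n)) : IsPMVec n k l (w ∘ σ) := by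
  obtain ⟨h0, hk, hl⟩ := hw
  refine ⟨fun i => h0 (σ i), ?_, ?_⟩
  · rw [← hk]
    exact Finset.card_equiv σ (by simp)
  · rw [← hl]
    exact Finset.card_equiv σ (by simp)

theorem Precedes.isPMVec {n k l : ℕ} {v w : Fin n → ℤ} (h : Precedes v w)
    (hw : IsPMVec n k l w) : IsPMVec n k l v := by
  obtain ⟨σ, rfl⟩ := h.exists_perm
  exact hw.comp_perm σ

/-- A shift exchanging a smaller entry with a later larger one. -/
theorem Precedes.swap {n : ℕ} {v w : Fin n → ℤ} (h : Precedes v w) {i j : Fin n}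
    (hij : i < j) (hle : v i ≤ v j) : Precedes (v ∘ Equiv.swap i j) w := by
  refine Relation.ReflTransGen.tail h ⟨i, j, hij, ?_⟩
  rw [max_eq_right hle, min_eq_left hle, Equiv.comp_swap_eq_update,
    Function.update_comm hij.ne]

/-- The positions `i < t` where `w` has a `-1` that has not been exchanged in `v`. -/
def unmatchedNeg {n : ℕ} (w v : Fin n → ℤ) (t : ℕ) : Finset (Fin n) :=
  Finset.univ.filter fun i => (i : ℕ) < t ∧ w i = -1 ∧ v i = -1

/-- The positions `i < t` where `w` has a `0` or `-1` that has not been exchanged in `v`. -/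
def unmatched {n : ℕ} (w v : Fin n → ℤ) (t : ℕ) : Finset (Fin n) :=
  Finset.univ.filter fun i => (i : ℕ) < t ∧ w i ≠ 1 ∧ v i = w i

/-- The positions `i < t` where `w` has a `1`. -/
def posBelow {n : ℕ} (w : Fin n → ℤ) (t : ℕ) : Finset (Fin n) :=
  Finset.univ.filter fun i => (i : ℕ) < t ∧ w i = 1

/-- The positions `i` with `s ≤ i < t`. -/
def window (n s t : ℕ) : Finset (Fin n) :=
  Finset.univ.filter fun i => s ≤ (i : ℕ) ∧ (i : ℕ) < t

theorem sum_window_succ {n : ℕ} (w : Fin n → ℤ) {s : ℕ} {i : Fin n} (hs : s ≤ i) :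
    ∑ j ∈ window n s (i + 1), w j = w i + ∑ j ∈ window n s i, w j := by
  have h : window n s (i + 1) = insert i (window n s i) := by
    ext j
    simp only [window, Finset.mem_filter, Finset.mem_univ, true_and, Finset.mem_insert, Fin.ext_iff]
    omega
  rw [h, Finset.sum_insert (by simp [window])]

theorem sum_window_self {n : ℕ} (w : Fin n → ℤ) (s : ℕ) : ∑ j ∈ window n s s, w j = 0 := by
  refine Finset.sum_eq_zero fun j hj => ?_
  simp only [window, Finset.mem_filter] at hj
  omega

/-- The state reached after greedily exchanging each `1` of `w` among the first `t` positions with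
an earlier unmatched entry, where a `-1` is preferred to a `0`. -/
structure GreedyState {n : ℕ} (w : Fin n → ℤ) (t : ℕ) (v : Fin n → ℤ) : Prop where
  precedes : Precedes v w
  eq_of_le : ∀ i : Fin n, t ≤ i → v i = w i
  pos : ∀ i : Fin n, (i : ℕ) < t → w i = 1 → v i = 0 ∨ v i = -1
  zero : ∀ i : Fin n, (i : ℕ) < t → w i = 0 → v i = 0 ∨ v i = 1
  neg : ∀ i : Fin n, (i : ℕ) < t → w i = -1 → v i = -1 ∨ v i = 1
  card_unmatched : (unmatched w v t).card + 2 * (posBelow w t).card = t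
  card_neg : ∃ s ≤ t, ((unmatchedNeg w v t).card : ℤ) = -∑ j ∈ window n s t, w j

theorem GreedyState.initial {n : ℕ} (w : Fin n → ℤ) : GreedyState w 0 w where
  precedes := Relation.ReflTransGen.refl
  eq_of_le _ _ := rfl
  pos _ h := absurd h (Nat.not_lt_zero _)
  zero _ h := absurd h (Nat.not_lt_zero _)
  neg _ h := absurd h (Nat.not_lt_zero _)
  card_unmatched := by simp [unmatched, posBelow]
  card_neg := ⟨0, le_rfl, by simp [unmatchedNeg, window]⟩

theorem GreedyState.succ_of_ne_one {n : ℕ} {w v : Fin n → ℤ} {t : Fin n}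
    (h : GreedyState w t v) (hw : w t = 0 ∨ w t = -1) : GreedyState w (t + 1) v := by
  have hvt := h.eq_of_le t le_rfl
  have hlt : ∀ i : Fin n, (i : ℕ) < t + 1 ↔ i = t ∨ (i : ℕ) < t := fun i => by
    rw [Fin.ext_iff]; omega
  have hU : unmatched w v (t + 1) = insert t (unmatched w v t) := by
    ext i
    simp only [unmatched, Finset.mem_filter, Finset.mem_univ, true_and, Finset.mem_insert, hlt]
    grind
  have hP : posBelow w (t + 1) = posBelow w t := by
    ext i
    simp only [posBelow, Finset.mem_filter, Finset.mem_univ, true_and, hlt]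
    grind
  refine ⟨h.precedes, fun i hi => h.eq_of_le i (by omega), ?_, ?_, ?_, ?_, ?_⟩
  · intro i hi hwi
    rcases (hlt i).1 hi with rfl | hi
    · omega
    · exact h.pos i hi hwi
  · intro i hi hwi
    rcases (hlt i).1 hi with rfl | hi
    · omega
    · exact h.zero i hi hwi
  · intro i hi hwi
    rcases (hlt i).1 hi with rfl | hi
    · omega
    · exact h.neg i hi hwi
  · rw [hU, hP, Finset.card_insert_of_notMem (by simp [unmatched])]
    have := h.card_unmatched
    omega
  · obtain ⟨s, hs, hcard⟩ := h.card_neg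
    refine ⟨s, by omega, ?_⟩
    rw [sum_window_succ w hs]
    rcases hw with hw | hw
    · have hN : unmatchedNeg w v (t + 1) = unmatchedNeg w v t := by
        ext i
        simp only [unmatchedNeg, Finset.mem_filter, Finset.mem_univ, true_and, hlt]
        grind
      rw [hN, hcard, hw, zero_add]
    · have hN : unmatchedNeg w v (t + 1) = insert t (unmatchedNeg w v t) := by
        ext i
        simp only [unmatchedNeg, Finset.mem_filter, Finset.mem_univ, true_and, Finset.mem_insert,
          hlt]
        grind
      rw [hN, Finset.card_insert_of_notMem (by simp [unmatchedNeg]), hw]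
      push_cast
      omega

theorem GreedyState.succ_of_eq_one {n : ℕ} {w v : Fin n → ℤ} {t : Fin n}
    (h : GreedyState w t v) (hval : ∀ i, w i = 0 ∨ w i = 1 ∨ w i = -1) (hw : w t = 1)
    (hP : 2 * (posBelow w t).card < t) : ∃ v', GreedyState w (t + 1) v' := by
  have hvt : v t = 1 := (h.eq_of_le t le_rfl).trans hw
  have hlt : ∀ i : Fin n, (i : ℕ) < t + 1 ↔ i = t ∨ (i : ℕ) < t := fun i => by
    rw [Fin.ext_iff]; omega
  obtain ⟨p, hp, hpN⟩ : ∃ p ∈ unmatched w v t,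
      p ∈ unmatchedNeg w v t ∨ unmatchedNeg w v t = ∅ := by
    rcases (unmatchedNeg w v t).eq_empty_or_nonempty with hN | ⟨p, hp⟩
    · have hU : (unmatched w v t).Nonempty := by
        rw [← Finset.card_pos]
        have := h.card_unmatched
        omega
      exact ⟨hU.choose, hU.choose_spec, Or.inr hN⟩
    · refine ⟨p, ?_, Or.inl hp⟩
      simp only [unmatchedNeg, unmatched, Finset.mem_filter, Finset.mem_univ, true_and] at hp ⊢
      omega
  have hp' := hp
  simp only [unmatched, Finset.mem_filter, Finset.mem_univ, true_and] at hp'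
  obtain ⟨hpt, hwp, hvp⟩ := hp'
  have hpt' : p < t := hpt
  set v' := v ∘ Equiv.swap p t with hv'
  have hv'p : v' p = 1 := by simp [hv', hvt]
  have hv't : v' t = w p := by simp [hv', hvp]
  have hv'o : ∀ i, i ≠ p → i ≠ t → v' i = v i := fun i h1 h2 => by
    simp [hv', Equiv.swap_apply_of_ne_of_ne h1 h2]
  have hU : unmatched w v' (t + 1) = (unmatched w v t).erase p := by
    ext i
    simp only [unmatched, Finset.mem_filter, Finset.mem_univ, true_and, Finset.mem_erase, hlt]
    grind
  have hPos : posBelow w (t + 1) = insert t (posBelow w t) := by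
    ext i
    simp only [posBelow, Finset.mem_filter, Finset.mem_univ, true_and, Finset.mem_insert, hlt]
    grind
  have hN : unmatchedNeg w v' (t + 1) = (unmatchedNeg w v t).erase p := by
    ext i
    simp only [unmatchedNeg, Finset.mem_filter, Finset.mem_univ, true_and, Finset.mem_erase, hlt]
    grind
  refine ⟨v', h.precedes.swap hpt' ?_, ?_, ?_, ?_, ?_, ?_, ?_⟩
  · have := hval p
    omega
  · intro i hi
    rw [hv'o i (by rintro rfl; omega) (by rintro rfl; omega)]
    exact h.eq_of_le i (by omega)
  · intro i hi hwi
    have := hval p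
    have := h.pos i
    grind
  · intro i hi hwi
    have := h.zero i
    grind
  · intro i hi hwi
    have := h.neg i
    grind
  · rw [hU, hPos, Finset.card_insert_of_notMem (by simp [posBelow]), Finset.card_erase_of_mem hp]
    have := h.card_unmatched
    have := Finset.card_pos.2 ⟨p, hp⟩
    omega
  · rw [hN]
    rcases hpN with hpN | hN0
    · obtain ⟨s, hs, hcard⟩ := h.card_neg
      refine ⟨s, by omega, ?_⟩
      have := Finset.card_pos.2 ⟨p, hpN⟩
      rw [sum_window_succ w hs, hw, Finset.card_erase_of_mem hpN]
      omega
    · exact ⟨t + 1, le_rfl, by rw [hN0, sum_window_self]; simp⟩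

theorem exists_greedyState {n : ℕ} {w : Fin n → ℤ} (hval : ∀ i, w i = 0 ∨ w i = 1 ∨ w i = -1)
    (hP : ∀ t : Fin n, w t = 1 → 2 * (posBelow w t).card < t) {t : ℕ} (ht : t ≤ n) :
    ∃ v, GreedyState w t v := by
  induction t with
  | zero => exact ⟨w, GreedyState.initial w⟩
  | succ t ih =>
    obtain ⟨v, hv⟩ := ih (by omega)
    lift t to Fin n using ht
    rcases hval t with h0 | h1 | h2
    · exact ⟨v, hv.succ_of_ne_one (Or.inl h0)⟩
    · exact hv.succ_of_eq_one hval h1 (hP t h1)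
    · exact ⟨v, hv.succ_of_ne_one (Or.inr h2)⟩

theorem two_mul_card_posBelow_lt {n : ℕ} {w : Fin n → ℤ}
    (hii : ∀ t : ℕ, 1 ≤ t →
      (Finset.univ.filter fun i : Fin n => w i = 1 ∧ (i : ℕ) + 1 ≤ 2 * t - 1).card ≤ t - 1)
    {t : Fin n} (ht : w t = 1) : 2 * (posBelow w t).card < t := by
  have hmono : ∀ s : ℕ, (t : ℕ) ≤ 2 * s - 1 → posBelow w t ⊆
      Finset.univ.filter fun i : Fin n => w i = 1 ∧ (i : ℕ) + 1 ≤ 2 * s - 1 := by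
    intro s hs i
    simp only [posBelow, Finset.mem_filter, Finset.mem_univ, true_and]
    omega
  rcases Nat.even_or_odd' (t : ℕ) with ⟨s, hs | hs⟩
  · have hlt : (posBelow w t).card < _ := Finset.card_lt_card
      (Finset.ssubset_iff_subset_ne.2 ⟨hmono (s + 1) (by omega), fun heq => ?_⟩)
    · have := hii (s + 1) (by omega)
      omega
    · have hmem : t ∈ posBelow w t := by
        rw [heq]
        simp only [Finset.mem_filter, Finset.mem_univ, true_and]
        omega
      simp [posBelow] at hmem
  · have := hii (s + 1) (by omega)
    have := Finset.card_le_card (hmono (s + 1) (by omega))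
    omega

theorem GreedyState.unmatchedNeg_eq_empty {n : ℕ} {w v : Fin n → ℤ} (h : GreedyState w n v)
    (hi : ∀ i : Fin n, 0 ≤ ∑ j ∈ Finset.univ.filter fun j => i ≤ j, w j) :
    unmatchedNeg w v n = ∅ := by
  obtain ⟨s, hs, hcard⟩ := h.card_neg
  rw [← Finset.card_eq_zero]
  rcases hs.eq_or_lt with rfl | hs
  · rw [sum_window_self] at hcard
    omega
  · have hwin : window n s n = Finset.univ.filter fun j => (⟨s, hs⟩ : Fin n) ≤ j := by
      ext j
      simp [window, Fin.le_def]
    have := hi ⟨s, hs⟩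
    rw [← hwin] at this
    omega

/-- Let `k ≥ l ≥ 1`, `n ≥ k + l` and `w ∈ V(n,k,l)` satisfy
(i) `Σ_{j ≥ i} w j ≥ 0` for every `i ∈ [n]`, and
(ii) `|S₊(w) ∩ [2t-1]| ≤ t - 1` for every integer `t ≥ 1`.
Then there exists `v ∈ V(n,k,l)` with `v ≺ w` and `⟨v,w⟩ = -2l`.
(Coordinate `i : Fin n` corresponds to the index `i + 1 ∈ [n]`.) -/
theorem stmt_8 (n k l : ℕ) (hl : 1 ≤ l) (hlk : l ≤ k) (hn : k + l ≤ n)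
    (w : Fin n → ℤ) (hw : IsPMVec n k l w)
    (hi : ∀ i : Fin n, 0 ≤ ∑ j ∈ Finset.univ.filter fun j => i ≤ j, w j)
    (hii : ∀ t : ℕ, 1 ≤ t →
      (Finset.univ.filter fun i : Fin n => w i = 1 ∧ (i : ℕ) + 1 ≤ 2 * t - 1).card
        ≤ t - 1) :
    ∃ v : Fin n → ℤ, IsPMVec n k l v ∧ Precedes v w ∧ dotZ v w = -2 * (l : ℤ) := by
  have hval := hw.1
  obtain ⟨v, hv⟩ := exists_greedyState hval (fun _ => two_mul_card_posBelow_lt hii) le_rfl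
  have hN := hv.unmatchedNeg_eq_empty hi
  have hvw := hv.precedes.isPMVec hw
  refine ⟨v, hvw, hv.precedes, ?_⟩
  have key : ∀ i, v i * w i = -(if w i = -1 then 1 else 0) - (if v i = -1 then 1 else 0) := by
    intro i
    rcases hval i with h | h | h
    · rcases hv.zero i i.2 h with h' | h' <;> simp [h, h']
    · rcases hv.pos i i.2 h with h' | h' <;> simp [h, h']
    · rcases hv.neg i i.2 h with h' | h'
      · have hmem : i ∈ unmatchedNeg w v n := by simp [unmatchedNeg, h, h']
        simp [hN] at hmem
      · simp [h, h']
  rw [dotZ, Finset.sum_congr rfl fun i _ => key i, Finset.sum_sub_distrib, Finset.sum_neg_distrib,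
    Finset.sum_boole, Finset.sum_boole, hw.2.2, hvw.2.2]
  ring
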